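/- Let D be an integral domain with quotient field K ≠ D. (i) If every t-linked extension of D is polynomially regular, then D is polynomially L-regular and D_p is absolutely polynomially regular for every t-maximal ideal p of D. (ii) If, in addition, Int(D) is flat as a D-module, then the converse holds: if D is polynomially L-regular and D_p is absolutely polynomially regular for every t-maximal ideal p of D, then every t-linked extension of D is polynomially regular. -/

import Mathlib

namespace IVP

open Polynomial

variable {F : Type} [Field F]

/-- Integer-valued polynomials on the set `E` with values in `D`:
`Int(E,D) = {f ∈ F[X] : f(E) ⊆ D}`. -/
def IntOn (E D : Set F) : Set (Polynomial F) := {f | ∀ x ∈ E, f.eval x ∈ D}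

/-- `Int(D) = {f ∈ F[X] : f(D) ⊆ D}`. -/
def IntR (D : Set F) : Set (Polynomial F) := IntOn D D

/-- Polynomials with all coefficients in `R`, i.e. `R[X]` as a subset of `F[X]`. -/
def polySet (R : Set F) : Set (Polynomial F) := {f | ∀ n, f.coeff n ∈ R}

/-- `I⁻¹ = (D :_K I) = {x : x·I ⊆ D}`. -/
def dinv (D I : Set F) : Set F := {x | ∀ y ∈ I, x * y ∈ D}

/-- `I_v = (I⁻¹)⁻¹`. -/
def dv (D I : Set F) : Set F := dinv D (dinv D I)

/-- `I_t = ⋃ J_v`, the union over all nonzero finitely generated fractional ideals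
`J ⊆ I`; such a `J` is the `D`-span of a finite set `T ⊆ I` containing a nonzero
element, and `J_v` depends only on `T`. -/
def dt (D I : Set F) : Set F :=
  {x | ∃ T : Finset F, ↑T ⊆ I ∧ (∃ y ∈ T, y ≠ 0) ∧ x ∈ dv D ↑T}

/-- The image in `F` of a set of elements of the subring `D`. -/
def iset (D : Subring F) (I : Set ↥D) : Set F := (↑) '' I

/-- `I` is a t-ideal: `I_t = I`. -/
def IsTIdeal (D I : Set F) : Prop := dt D I = I

/-- `I` is a v-ideal: `I_v = I`. -/
def IsVIdeal (D I : Set F) : Prop := dv D I = I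

/-- `p` is a t-maximal ideal of `D`: maximal among the t-ideals properly contained
in `D`. -/
def IsTMax (D : Subring F) (p : Ideal ↥D) : Prop :=
  p ≠ ⊤ ∧ IsTIdeal ↑D (iset D ↑p) ∧
    ∀ q : Ideal ↥D, q ≠ ⊤ → IsTIdeal ↑D (iset D ↑q) → p ≤ q → p = q

/-- `p` is a v-maximal ideal of `D`: maximal among the v-ideals properly contained
in `D`. -/
def IsVMax (D : Subring F) (p : Ideal ↥D) : Prop :=
  p ≠ ⊤ ∧ IsVIdeal ↑D (iset D ↑p) ∧
    ∀ q : Ideal ↥D, q ≠ ⊤ → IsVIdeal ↑D (iset D ↑q) → p ≤ q → p = q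

/-- The localization `S⁻¹D` of `D` at a multiplicative subset `S ⊆ D`, as a subset
of `F`. -/
def mlocSet (D : Subring F) (S : Set ↥D) : Set F :=
  {x | ∃ a : ↥D, ∃ s ∈ S, (s : F) * x = (a : F)}

/-- The localization `D_p` of `D` at the complement of `p`, as a subset of `F`. -/
def plocSet (D : Subring F) (p : Ideal ↥D) : Set F := mlocSet D {s | s ∉ p}

/-- The localization `S⁻¹R` of a set `R` of polynomials at a multiplicative subset
`S ⊆ D`, as a subset of `F[X]`. -/
def mlocPoly (D : Subring F) (S : Set ↥D) (R : Set (Polynomial F)) : Set (Polynomial F) :=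
  {f | ∃ g ∈ R, ∃ s ∈ S, C (s : F) * f = g}

/-- The localization `R_p` of a set `R` of polynomials at `D ∖ p`. -/
def plocPoly (D : Subring F) (p : Ideal ↥D) (R : Set (Polynomial F)) : Set (Polynomial F) :=
  mlocPoly D {s | s ∉ p} R

/-- The ideal `pD_p` of the localization `D_p`, as a subset of `F`. -/
def plocIdl (D : Subring F) (p : Ideal ↥D) : Set F :=
  {x | ∃ y ∈ p, ∃ s : ↥D, s ∉ p ∧ (s : F) * x = ((y : ↥D) : F)}

/-- `p` is t-localizing: `pD_p` is a t-ideal of `D_p`. -/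
def TLocalizing (D : Subring F) (p : Ideal ↥D) : Prop :=
  IsTIdeal (plocSet D p) (plocIdl D p)

/-- `F` is the quotient field of `D`. -/
def IsQuotField (D : Subring F) : Prop :=
  ∀ x : F, ∃ a b : ↥D, b ≠ 0 ∧ (b : F) * x = (a : F)

/-- The quotient field of `D`, as a subset of the ambient field. -/
def fracSet (D : Subring F) : Set F :=
  {x | ∃ a b : ↥D, b ≠ 0 ∧ (b : F) * x = (a : F)}

/-- The conductor ideal `(aD :_D bD) = {d ∈ D : d·b ∈ aD}` of `D`. -/
def Conductor (D : Subring F) (a b : ↥D) : Set ↥D := {d | ∃ c : ↥D, d * b = a * c}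

/-- Elementwise product of two subsets of `F`. -/
def setMul (A B : Set F) : Set F := {z | ∃ x ∈ A, ∃ y ∈ B, z = x * y}

/-- The ideal `I` of `D` is t-invertible: `(I⁻¹I)_t = D`. -/
def TInv (D : Subring F) (I : Ideal ↥D) : Prop :=
  dt ↑D (setMul (dinv ↑D (iset D ↑I)) (iset D ↑I)) = (↑D : Set F)

/-- The ideal `I` of `D` is v-invertible: `(I⁻¹I)_v = D`. -/
def VInv (D : Subring F) (I : Ideal ↥D) : Prop :=
  dv ↑D (setMul (dinv ↑D (iset D ↑I)) (iset D ↑I)) = (↑D : Set F)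

/-- `D` is a PVMD: every nonzero finitely generated ideal of `D` is t-invertible. -/
def IsPVMD (D : Subring F) : Prop :=
  ∀ I : Ideal ↥D, I ≠ ⊥ → I.FG → TInv D I

/-- `D` is an H domain: every v-invertible nonzero ideal of `D` is t-invertible. -/
def IsHDomain (D : Subring F) : Prop :=
  ∀ I : Ideal ↥D, I ≠ ⊥ → VInv D I → TInv D I

/-- `p ∈ sKr(K/D)`: `p` is a prime such that every finitely generated ideal
`I ⊆ p` satisfies `I ⊆ J ⊆ p` for some conductor ideal `J` of `D`. -/
def SKrMem (D : Subring F) (p : Ideal ↥D) : Prop :=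
  p.IsPrime ∧ ∀ I : Ideal ↥D, I.FG → I ≤ p →
    ∃ a b : ↥D, a ≠ 0 ∧ (↑I : Set ↥D) ⊆ Conductor D a b ∧ Conductor D a b ⊆ ↑p

/-- The localization `A_p` of `A ⊇ D` at the complement in `D` of a prime `p` of `D`,
as a subset of the ambient field. -/
def mixedLocSet (D A : Subring F) (p : Ideal ↥D) : Set F :=
  {x | ∃ a : ↥A, ∃ s : ↥D, s ∉ p ∧ (s : F) * x = (a : F)}

/-- `pD_p` is a principal ideal of `D_p`. -/
def PLocPrincipal (D : Subring F) (p : Ideal ↥D) : Prop :=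
  ∃ g : F, plocIdl D p = {x | ∃ d ∈ plocSet D p, x = d * g}

/-- The localization `A_p` of `A ⊇ D` at a prime `p` of `D`, as a subring of the
ambient field. -/
def mixedLoc (D A : Subring F) (hDA : D ≤ A) (p : Ideal ↥D) (hp : p.IsPrime) :
    Subring F where
  carrier := mixedLocSet D A p
  one_mem' := ⟨1, 1, fun h => hp.ne_top (Ideal.eq_top_of_isUnit_mem p h isUnit_one), by simp⟩
  zero_mem' := ⟨0, 1, fun h => hp.ne_top (Ideal.eq_top_of_isUnit_mem p h isUnit_one), by simp⟩
  mul_mem' := by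
    rintro x y ⟨a, s, hs, hx⟩ ⟨b, t, ht, hy⟩
    refine ⟨a * b, s * t, fun h => ((hp.mem_or_mem h).elim hs ht), ?_⟩
    push_cast
    rw [mul_mul_mul_comm, hx, hy]
  add_mem' := by
    rintro x y ⟨a, s, hs, hx⟩ ⟨b, t, ht, hy⟩
    refine ⟨⟨t, hDA t.2⟩ * a + ⟨s, hDA s.2⟩ * b, s * t,
      fun h => ((hp.mem_or_mem h).elim hs ht), ?_⟩
    push_cast
    rw [mul_add]
    rw [show ((s:F) * t) * x = (t:F) * ((s:F) * x) by ring, hx,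
      show ((s:F) * t) * y = (s:F) * ((t:F) * y) by ring, hy]
  neg_mem' := by
    rintro x ⟨a, s, hs, hx⟩
    exact ⟨-a, s, hs, by push_cast; rw [mul_neg, hx]⟩

/-- The localization `D_p` of `D` at a prime `p`, as a subring of `F`. -/
def primeLoc (D : Subring F) (p : Ideal ↥D) (hp : p.IsPrime) : Subring F :=
  mixedLoc D D le_rfl p hp

/-- `Int(D)` as a subring of `F[X]`. -/
def IntSubring (D : Subring F) : Subring (Polynomial F) where
  carrier := IntR ↑D
  one_mem' := fun x _ => by simpa using D.one_mem
  zero_mem' := fun x _ => by simpa using D.zero_mem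
  mul_mem' := fun hf hg x hx => by
    rw [eval_mul]; exact D.mul_mem (hf x hx) (hg x hx)
  add_mem' := fun hf hg x hx => by
    rw [eval_add]; exact D.add_mem (hf x hx) (hg x hx)
  neg_mem' := fun hf x hx => by
    rw [eval_neg]; exact D.neg_mem (hf x hx)

/-- `Int(D)` as a `D`-submodule of `F[X]`. -/
def intSubmodule (D : Subring F) : Submodule ↥D (Polynomial F) where
  carrier := IntR ↑D
  zero_mem' := fun x _ => by simpa using D.zero_mem
  add_mem' := fun hf hg x hx => by
    rw [eval_add]; exact D.add_mem (hf x hx) (hg x hx)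
  smul_mem' := fun c f hf x hx => by
    have h : c • f = C (c : F) * f := by
      rw [Algebra.smul_def]; rfl
    rw [h, eval_mul, eval_C]
    exact D.mul_mem c.2 (hf x hx)

/-- An overring `D'` of `D` as a `D`-submodule of `F`. -/
def subringSubmodule (D D' : Subring F) (h : D ≤ D') : Submodule ↥D F where
  carrier := ↑D'
  zero_mem' := D'.zero_mem
  add_mem' := fun ha hb => D'.add_mem ha hb
  smul_mem' := fun c x hx => by
    rw [Subring.smul_def]
    exact D'.mul_mem (h c.2) hx

/-- `Int(D)_p` as a `D_p`-submodule of `F[X]`. -/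
def plocIntSubmodule (D : Subring F) (p : Ideal ↥D) (hp : p.IsPrime) :
    Submodule ↥(primeLoc D p hp) (Polynomial F) where
  carrier := plocPoly D p (IntR ↑D)
  zero_mem' :=
    ⟨0, fun x _ => by simpa using D.zero_mem, 1,
      fun h => hp.ne_top (Ideal.eq_top_of_isUnit_mem p h isUnit_one), by simp⟩
  add_mem' := by
    rintro f f' ⟨g, hg, s, hs, hfg⟩ ⟨g', hg', t, ht, hfg'⟩
    refine ⟨C (t : F) * g + C (s : F) * g', ?_, s * t,
      fun h => ((hp.mem_or_mem h).elim hs ht), ?_⟩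
    · intro x hx
      rw [eval_add, eval_mul, eval_mul, eval_C, eval_C]
      exact D.add_mem (D.mul_mem t.2 (hg x hx)) (D.mul_mem s.2 (hg' x hx))
    · rw [← hfg, ← hfg']
      push_cast
      rw [map_mul]
      ring
  smul_mem' := by
    rintro c f ⟨g, hg, t, ht, hfg⟩
    obtain ⟨a, s, hs, hsc⟩ := c.2
    have h : c • f = C (c : F) * f := by rw [Algebra.smul_def]; rfl
    refine ⟨C (a : F) * g, ?_, s * t,
      fun hmem => ((hp.mem_or_mem hmem).elim hs ht), ?_⟩
    · intro x hx
      rw [eval_mul, eval_C]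
      exact D.mul_mem a.2 (hg x hx)
    · rw [h, ← hfg, ← hsc]
      push_cast
      rw [map_mul, map_mul]
      ring

section Extensions

variable {L : Type} [Field L]

/-- The data of an extension: the subring `A` of `L` contains the image of `D`
under the embedding `φ` of quotient fields. -/
def ExtMem (D : Subring F) (φ : F →+* L) (A : Subring L) : Prop := ∀ d : ↥D, φ d ∈ A

/-- The injective ring homomorphism `D → A` induced by `φ`. -/
noncomputable def extHom (D : Subring F) (φ : F →+* L) (A : Subring L)
    (h : ExtMem D φ A) : ↥D →+* ↥A :=
  (φ.comp D.subtype).codRestrict A.toSubsemiring (fun d => h d)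

/-- The extension `A ⊇ D` is polynomially regular: `Int(D,A) = A·Int(D)`. -/
def PolyReg (D : Subring F) (φ : F →+* L) (A : Subring L) : Prop :=
  IntOn (φ '' ↑D) ↑A = ↑(Submodule.span ↥A (Polynomial.map φ '' IntR (↑D : Set F)))

/-- The extension `A ⊇ D` is weakly polynomially complete: `Int(D) ⊆ Int(A)`. -/
def WPolyComplete (D : Subring F) (φ : F →+* L) (A : Subring L) : Prop :=
  Polynomial.map φ '' IntR (↑D : Set F) ⊆ IntR (↑A : Set L)

/-- The extension `A ⊇ D` is polynomially complete: `Int(D,A) = Int(A)`. -/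
def PolyComplete (D : Subring F) (φ : F →+* L) (A : Subring L) : Prop :=
  IntOn (φ '' ↑D) ↑A = IntR (↑A : Set L)

/-- The extension `A ⊇ D` is flat: `A` is flat as a `D`-module. -/
def ExtFlat (D : Subring F) (φ : F →+* L) (A : Subring L) (h : ExtMem D φ A) : Prop :=
  letI : Module ↥D ↥A := Module.compHom ↥A (extHom D φ A h)
  Module.Flat ↥D ↥A

/-- The extension `A ⊇ D` is t-linked: `I_t = D` implies `(IA)_t = A` for every
nonzero ideal `I` of `D`. -/
def TLinkedExt (D : Subring F) (φ : F →+* L) (A : Subring L) (h : ExtMem D φ A) : Prop :=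
  ∀ I : Ideal ↥D, I ≠ ⊥ → dt ↑D (iset D ↑I) = (↑D : Set F) →
    dt ↑A (iset A ↑(Ideal.map (extHom D φ A h) I)) = (↑A : Set L)

/-- `D` is absolutely polynomially regular: every extension of `D` is polynomially
regular. -/
def AbsPolyReg (D : Subring F) : Prop :=
  ∀ (L : Type) [Field L], ∀ (φ : F →+* L) (A : Subring L),
    ExtMem D φ A → IsQuotField A → PolyReg D φ A

/-- `D` is polynomially F-regular: every flat extension of `D` is polynomially
regular. -/
def PFReg (D : Subring F) : Prop :=
  ∀ (L : Type) [Field L], ∀ (φ : F →+* L) (A : Subring L) (h : ExtMem D φ A),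
    IsQuotField A → ExtFlat D φ A h → PolyReg D φ A

/-- `D` is polynomially t-regular: every t-linked extension of `D` is polynomially
regular. -/
def PTReg (D : Subring F) : Prop :=
  ∀ (L : Type) [Field L], ∀ (φ : F →+* L) (A : Subring L) (h : ExtMem D φ A),
    IsQuotField A → TLinkedExt D φ A h → PolyReg D φ A

/-- `D` is polynomially L-regular: `Int(S⁻¹D) = S⁻¹Int(D)` for every multiplicative
subset `S` of `D` with `0 ∉ S`. -/
def PLReg (D : Subring F) : Prop :=
  ∀ S : Submonoid ↥D, (0 : ↥D) ∉ S →
    IntR (mlocSet D ↑S) = mlocPoly D ↑S (IntR (↑D : Set F))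

end Extensions

/-- The extension of an ideal `I` of `R` to an overring `S` of `R` inside a common
field: the ideal `IS` of `S` generated by `I`. -/
def extIdeal (R S : Subring F) (I : Ideal ↥R) : Ideal ↥S :=
  Ideal.span {y : ↥S | (y : F) ∈ iset R ↑I}

/-- Within a common field: `S` is a t-linked extension of `R`. -/
def TLinkedSub (R S : Subring F) : Prop :=
  R ≤ S ∧ ∀ I : Ideal ↥R, I ≠ ⊥ → dt ↑R (iset R ↑I) = (↑R : Set F) →
    dt ↑S (iset S ↑(extIdeal R S I)) = (↑S : Set F)

/-- Localization of a subset `R` of the ambient field at `D ∖ q`. -/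
def locOfSet (D : Subring F) (R : Set F) (q : Ideal ↥D) : Set F :=
  {x | ∃ y ∈ R, ∃ s : ↥D, s ∉ q ∧ (s : F) * x = y}

end IVP

open IVP Polynomial

namespace IVP

variable {F : Type} [Field F] {L : Type} [Field L]

theorem dv_mono {D I J : Set F} (h : I ⊆ J) : dv D I ⊆ dv D J :=
  fun _ hx y hy => hx y fun z hz => hy z (h hz)

theorem dt_mono {D I J : Set F} (h : I ⊆ J) : dt D I ⊆ dt D J :=
  fun _ ⟨T, hT, h0, hx⟩ => ⟨T, hT.trans h, h0, hx⟩

theorem dv_le_of_subset_dv {D I J : Set F} (h : I ⊆ dv D J) : dv D I ⊆ dv D J := by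
  intro x hx y hy
  refine hx y fun z hz => ?_
  rw [mul_comm]
  exact h hz y hy

theorem subset_dv (D I : Set F) : I ⊆ dv D I := by
  intro x hx y hy
  rw [mul_comm]
  exact hy x hx

theorem zero_mem_dv (D : Subring F) (I : Set F) : (0 : F) ∈ dv (D : Set F) I := by
  intro y _
  simp [D.zero_mem]

theorem add_mem_dv {D : Subring F} {I : Set F} {x y : F} (hx : x ∈ dv (D : Set F) I)
    (hy : y ∈ dv (D : Set F) I) : x + y ∈ dv (D : Set F) I := by
  intro z hz
  rw [add_mul]
  exact D.add_mem (hx z hz) (hy z hz)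

theorem mul_mem_dv {D : Subring F} {I : Set F} {c x : F} (hc : c ∈ D)
    (hx : x ∈ dv (D : Set F) I) : c * x ∈ dv (D : Set F) I := by
  intro z hz
  rw [mul_assoc]
  exact D.mul_mem hc (hx z hz)

theorem dt_subset {D : Subring F} {I : Set F} (hI : I ⊆ D) : dt (D : Set F) I ⊆ D := by
  rintro x ⟨T, hT, -, hx⟩
  have := hx 1 fun y hy => by simpa using hI (hT hy)
  simpa using this

theorem iset_subset (D : Subring F) (I : Ideal D) : iset D (I : Set D) ⊆ D := by
  rintro _ ⟨x, -, rfl⟩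
  exact x.2

theorem coe_mem_iset {D : Subring F} {I : Ideal D} {x : D} :
    (x : F) ∈ iset D (I : Set D) ↔ x ∈ I :=
  ⟨fun ⟨_, hy, h⟩ => Subtype.ext h ▸ hy, fun h => ⟨x, h, rfl⟩⟩

theorem iset_mono {D : Subring F} {I J : Ideal D} (h : I ≤ J) :
    iset D (I : Set D) ⊆ iset D (J : Set D) :=
  Set.image_mono h

theorem dt_eq_of_one_mem {D : Subring F} {I : Set F} (hI : I ⊆ D)
    (h1 : (1 : F) ∈ dt (D : Set F) I) : dt (D : Set F) I = D := by
  refine (dt_subset hI).antisymm fun x hx => ?_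
  obtain ⟨T, hT, h0, h⟩ := h1
  exact ⟨T, hT, h0, by simpa using mul_mem_dv hx h⟩

/-- The `t`-closure of a nonzero ideal, as an ideal. -/
def tClosure (D : Subring F) (I : Ideal D) (hI : I ≠ ⊥) : Ideal D where
  carrier := {x | (x : F) ∈ dt (D : Set F) (iset D (I : Set D))}
  zero_mem' := by
    obtain ⟨y, hy, hy0⟩ := Submodule.exists_mem_ne_zero_of_ne_bot hI
    exact ⟨{(y : F)}, by simp [coe_mem_iset.2 hy], ⟨y, by simp, by simpa using hy0⟩,
      zero_mem_dv D _⟩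
  add_mem' := by
    classical
    rintro x y ⟨T, hT, ⟨z, hz, hz0⟩, hx⟩ ⟨U, hU, -, hy⟩
    refine ⟨T ∪ U, by simp [hT, hU], ⟨z, by simp [hz], hz0⟩, ?_⟩
    exact add_mem_dv (dv_mono (by simp) hx) (dv_mono (by simp) hy)
  smul_mem' := by
    rintro c x ⟨T, hT, h0, hx⟩
    exact ⟨T, hT, h0, mul_mem_dv c.2 hx⟩

theorem le_tClosure (D : Subring F) (I : Ideal D) (hI : I ≠ ⊥) : I ≤ tClosure D I hI := by
  intro x hx
  by_cases h0 : x = 0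
  · subst h0
    exact zero_mem _
  · exact ⟨{(x : F)}, by simp [coe_mem_iset.2 hx], ⟨x, by simp, by simpa using h0⟩,
      subset_dv _ _ (by simp)⟩

theorem iset_tClosure (D : Subring F) (I : Ideal D) (hI : I ≠ ⊥) :
    iset D (tClosure D I hI : Set D) = dt (D : Set F) (iset D (I : Set D)) := by
  refine Set.Subset.antisymm ?_ fun x hx => ⟨⟨x, dt_subset (iset_subset D I) hx⟩, hx, rfl⟩
  rintro _ ⟨x, hx, rfl⟩
  exact hx

theorem dt_dt_subset (D : Set F) (I : Set F) : dt D (dt D I) ⊆ dt D I := by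
  classical
  rintro x ⟨T, hT, ⟨y, hy, -⟩, hx⟩
  choose! U hU hU0 hUv using hT
  obtain ⟨z, hz, hz0⟩ := hU0 hy
  refine ⟨T.biUnion U, ?_, ⟨z, Finset.mem_biUnion.2 ⟨y, hy, hz⟩, hz0⟩, ?_⟩
  · intro w hw
    obtain ⟨t, ht, hw⟩ := Finset.mem_biUnion.1 (Finset.mem_coe.1 hw)
    exact hU ht hw
  · refine dv_le_of_subset_dv (fun t ht => ?_) hx
    exact dv_mono (Finset.coe_subset.2 (Finset.subset_biUnion_of_mem U ht)) (hUv ht)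

/-- An ideal whose `t`-closure is proper lies in a `t`-maximal ideal, which is prime. -/
theorem exists_isTMax_of_ne_bot {D : Subring F} {I : Ideal D} (hI : I ≠ ⊥)
    (h1 : (1 : F) ∉ dt (D : Set F) (iset D (I : Set D))) :
    ∃ p : Ideal D, p.IsPrime ∧ IsTMax D p ∧ I ≤ p := by
  classical
  obtain ⟨p, hIp, hmax⟩ := zorn_le_nonempty₀
    {J : Ideal D | (1 : F) ∉ dt (D : Set F) (iset D (J : Set D))}
    (fun c hc hchain J₀ hJ₀ => by
      refine ⟨sSup c, ?_, fun J hJ => le_sSup hJ⟩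
      rintro ⟨T, hT, h0, hv⟩
      have key : ∀ U : Finset F, (U : Set F) ⊆ iset D (sSup c : Ideal D) →
          ∃ J ∈ c, (U : Set F) ⊆ iset D (J : Set D) := by
        intro U
        induction U using Finset.induction_on with
        | empty => exact fun _ => ⟨J₀, hJ₀, by simp⟩
        | insert a U _ ih =>
          intro hU
          rw [Finset.coe_insert, Set.insert_subset_iff] at hU
          obtain ⟨J, hJ, hUJ⟩ := ih hU.2
          obtain ⟨x, hx, rfl⟩ := hU.1
          obtain ⟨J', hJ', hxJ'⟩ :=
            (Submodule.mem_sSup_of_directed ⟨J₀, hJ₀⟩ hchain.directedOn).1 hx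
          obtain ⟨M, hM, hJM, hJ'M⟩ := hchain.directedOn J hJ J' hJ'
          refine ⟨M, hM, ?_⟩
          rw [Finset.coe_insert, Set.insert_subset_iff]
          exact ⟨coe_mem_iset.2 (hJ'M hxJ'), hUJ.trans (iset_mono hJM)⟩
      obtain ⟨J, hJ, hTJ⟩ := key T hT
      exact hc hJ ⟨T, hTJ, h0, hv⟩) I h1
  have hp0 : p ≠ ⊥ := fun h => hI (le_bot_iff.1 (h ▸ hIp))
  have hp1 : (1 : F) ∉ dt (D : Set F) (iset D (p : Set D)) := hmax.prop
  have hle : ∀ q : Ideal D, p ≤ q → (1 : F) ∉ dt (D : Set F) (iset D (q : Set D)) → q ≤ p :=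
    fun q hpq hq => hmax.le_of_ge hq hpq
  have ht : tClosure D p hp0 ≤ p := by
    refine hle _ (le_tClosure D p hp0) fun h => hp1 ?_
    rw [iset_tClosure] at h
    exact dt_dt_subset _ _ h
  have hpt : IsTIdeal (D : Set F) (iset D (p : Set D)) := by
    rw [IsTIdeal, ← iset_tClosure D p hp0, ht.antisymm (le_tClosure D p hp0)]
  have hp1' : (1 : D) ∉ p := fun h => hp1 (by
    rw [hpt]
    exact coe_mem_iset.2 h)
  refine ⟨p, ?_, ⟨(Ideal.ne_top_iff_one p).2 hp1', hpt, fun q hq hqt hpq =>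
    hpq.antisymm (hle q hpq fun h => hq ?_)⟩, hIp⟩
  · refine ⟨(Ideal.ne_top_iff_one p).2 hp1', fun {a b} hab => or_iff_not_imp_left.2 fun ha => ?_⟩
    have hcolon : Submodule.comap (LinearMap.mul D D a) p ≤ p := by
      refine hle _ (fun x hx => p.mul_mem_left a hx) ?_
      rintro ⟨T, hT, ⟨y, hy, hy0⟩, hv⟩
      refine ha (ht ⟨T.image ((a : F) * ·), ?_, ⟨a * y, Finset.mem_image_of_mem _ hy, ?_⟩, ?_⟩)
      · intro w hw
        obtain ⟨t, ht', rfl⟩ := Finset.mem_image.1 (Finset.mem_coe.1 hw)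
        obtain ⟨x, hx, rfl⟩ := hT ht'
        exact ⟨a * x, hx, rfl⟩
      · refine mul_ne_zero (fun h => ha ?_) hy0
        rw [Subtype.ext (a1 := a) (a2 := 0) h]
        exact zero_mem _
      · intro z hz
        rw [← one_mul ((a : F) * z)]
        refine hv _ fun t ht' => ?_
        rw [mul_right_comm, mul_comm _ z]
        exact hz _ (Finset.mem_coe.2 (Finset.mem_image_of_mem _ ht'))
    exact hcolon hab
  · rw [hqt] at h
    exact (Ideal.eq_top_iff_one q).2 (coe_mem_iset.1 h)

theorem exists_isTMax {D : Subring F} (hqf : IsQuotField D) (hne : (D : Set F) ≠ Set.univ)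
    {I : Ideal D} (h1 : (1 : F) ∉ dt (D : Set F) (iset D (I : Set D))) :
    ∃ p : Ideal D, p.IsPrime ∧ IsTMax D p ∧ I ≤ p := by
  by_cases hI : I = ⊥
  · obtain ⟨x, hx⟩ := (Set.ne_univ_iff_exists_notMem _).1 hne
    obtain ⟨a, b, hb, hab⟩ := hqf x
    have hb0 : (b : F) ≠ 0 := by simpa using hb
    have hinv : (b : F)⁻¹ ∉ D := fun h => hx (by
      have : x = (b : F)⁻¹ * a := by rw [← hab, inv_mul_cancel_left₀ hb0]
      rw [this]
      exact D.mul_mem h a.2)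
    obtain ⟨p, hp, hpt, -⟩ := exists_isTMax_of_ne_bot (I := Ideal.span {b})
      (by simpa [Ideal.span_singleton_eq_bot] using hb) (by
        rintro ⟨T, hT, -, hv⟩
        suffices h : (b : F)⁻¹ ∈ dinv (D : Set F) T from hinv (by simpa using hv _ h)
        intro y hy
        obtain ⟨z, hz, rfl⟩ := hT hy
        obtain ⟨c, rfl⟩ := Ideal.mem_span_singleton.1 hz
        simp [hb0])
    exact ⟨p, hp, hpt, hI ▸ bot_le⟩
  · exact exists_isTMax_of_ne_bot hI h1

/-- Polynomials mapping `D` into a ring where `s` is invertible also map `s⁻¹D` there. -/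
theorem eval_mem_of_mul_mem {D : Subring F} {φ : F →+* L} {B : Subring L}
    (hDB : ExtMem D φ B) {s : F} (hs : s ∈ D) (hs0 : s ≠ 0) (hsB : (φ s)⁻¹ ∈ B)
    {x : F} (hx : s * x ∈ D) {f : L[X]} (hf : f ∈ IntOn (φ '' (D : Set F)) (B : Set L)) :
    f.eval (φ x) ∈ B := by
  have key : ∀ n : ℕ, ∀ f : L[X], (∀ m, n ≤ m → f.coeff m = 0) →
      f ∈ IntOn (φ '' (D : Set F)) (B : Set L) → f.eval (φ x) ∈ B := by
    intro n
    induction n with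
    | zero =>
      intro f hf _
      have : f = 0 := Polynomial.ext fun m => by simpa using hf m m.zero_le
      simp [this, B.zero_mem]
    | succ n ih =>
      intro f hdeg hf
      have hg := ih (C (φ s ^ n) * f - f.comp (C (φ s) * X)) (fun m hm => by
        rw [coeff_sub, coeff_C_mul, comp_C_mul_X_coeff]
        rcases hm.eq_or_lt with rfl | h
        · ring
        · simp [hdeg m h]) (by
        rintro _ ⟨d, hd, rfl⟩
        have h1 := hf _ ⟨d, hd, rfl⟩
        have h2 := hf _ ⟨s * d, D.mul_mem hs hd, rfl⟩
        have h3 : φ s ∈ B := hDB ⟨s, hs⟩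
        simp only [eval_sub, eval_mul, eval_C, eval_comp, eval_X]
        rw [map_mul] at h2
        exact B.sub_mem (B.mul_mem (B.pow_mem h3 n) h1) h2)
      have h2 := hf _ ⟨s * x, hx, rfl⟩
      simp only [eval_sub, eval_mul, eval_C, eval_comp, eval_X] at hg
      rw [map_mul] at h2
      have h4 := B.mul_mem (B.pow_mem hsB n) (B.add_mem hg h2)
      rwa [sub_add_cancel, ← mul_assoc, ← mul_pow,
        inv_mul_cancel₀ ((map_ne_zero φ).2 hs0), one_pow, one_mul] at h4
  exact key (f.natDegree + 1) f (fun m hm => coeff_eq_zero_of_natDegree_lt hm) hf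

theorem subring_smul_eq_C_mul {A : Subring L} (a : A) (f : L[X]) : a • f = C (a : L) * f := by
  rw [← smul_eq_C_mul]
  rfl

theorem span_subset_intOn {D : Subring F} {φ : F →+* L} {A : Subring L} (h : ExtMem D φ A) :
    (Submodule.span A (Polynomial.map φ '' IntR (D : Set F)) : Set L[X]) ⊆
      IntOn (φ '' (D : Set F)) (A : Set L) := by
  intro f hf
  induction hf using Submodule.span_induction with
  | mem f hf =>
    obtain ⟨g, hg, rfl⟩ := hf
    rintro _ ⟨d, hd, rfl⟩
    rw [eval_map_apply]
    exact h ⟨_, hg d hd⟩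
  | zero =>
    intro x _
    simp [A.zero_mem]
  | add f g _ _ hf hg =>
    intro x hx
    rw [eval_add]
    exact A.add_mem (hf x hx) (hg x hx)
  | smul a f _ hf =>
    intro x hx
    rw [subring_smul_eq_C_mul, eval_mul, eval_C]
    exact A.mul_mem a.2 (hf x hx)

/-- The localization of an extension `A` of `D` at a multiplicative subset of `D`. -/
def extLoc (D : Subring F) (φ : F →+* L) (A : Subring L) (h : ExtMem D φ A)
    (S : Submonoid D) : Subring L where
  carrier := {x | ∃ s ∈ S, φ s * x ∈ A}
  one_mem' := ⟨1, S.one_mem, by simp [A.one_mem]⟩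
  zero_mem' := ⟨1, S.one_mem, by simp [A.zero_mem]⟩
  mul_mem' := by
    rintro x y ⟨s, hs, hx⟩ ⟨t, ht, hy⟩
    refine ⟨s * t, S.mul_mem hs ht, ?_⟩
    push_cast
    rw [map_mul, mul_mul_mul_comm]
    exact A.mul_mem hx hy
  add_mem' := by
    rintro x y ⟨s, hs, hx⟩ ⟨t, ht, hy⟩
    refine ⟨s * t, S.mul_mem hs ht, ?_⟩
    have : φ ((s * t : D) : F) * (x + y) = φ t * (φ s * x) + φ s * (φ t * y) := by
      push_cast
      rw [map_mul]
      ring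
    rw [this]
    exact A.add_mem (A.mul_mem (h t) hx) (A.mul_mem (h s) hy)
  neg_mem' := by
    rintro x ⟨s, hs, hx⟩
    exact ⟨s, hs, by simpa using hx⟩

theorem le_extLoc {D : Subring F} {φ : F →+* L} {A : Subring L} (h : ExtMem D φ A)
    (S : Submonoid D) : A ≤ extLoc D φ A h S :=
  fun x hx => ⟨1, S.one_mem, by simpa using hx⟩

theorem extMem_id (D : Subring F) : ExtMem D (RingHom.id F) D := fun d => d.2

theorem coe_extLoc_id (D : Subring F) (S : Submonoid D) :
    (extLoc D (RingHom.id F) D (extMem_id D) S : Set F) = mlocSet D S := by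
  ext x
  exact ⟨fun ⟨s, hs, hx⟩ => ⟨⟨_, hx⟩, s, hs, rfl⟩, fun ⟨a, s, hs, hx⟩ => ⟨s, hs, by
    rw [RingHom.id_apply, hx]
    exact a.2⟩⟩

theorem inv_mem_extLoc {D : Subring F} {φ : F →+* L} {A : Subring L} (h : ExtMem D φ A)
    {S : Submonoid D} (hS : (0 : D) ∉ S) {s : D} (hs : s ∈ S) :
    (φ s)⁻¹ ∈ extLoc D φ A h S := by
  refine ⟨s, hs, ?_⟩
  have : (s : F) ≠ 0 := fun h0 => hS (Subtype.ext (a1 := s) (a2 := 0) h0 ▸ hs)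
  rw [mul_inv_cancel₀ ((map_ne_zero φ).2 this)]
  exact A.one_mem

theorem IsQuotField.mono {A B : Subring L} (hA : IsQuotField A) (hAB : A ≤ B) :
    IsQuotField B := fun x => by
  obtain ⟨a, b, hb, hx⟩ := hA x
  refine ⟨⟨a, hAB a.2⟩, ⟨b, hAB b.2⟩, fun h => hb ?_, hx⟩
  exact Subtype.ext (congrArg (fun z : B => (z : L)) h)

theorem intOn_subset_intOn_extLoc {D : Subring F} {φ : F →+* L} {A : Subring L}
    (h : ExtMem D φ A) {S : Submonoid D} (hS : (0 : D) ∉ S) :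
    IntOn (φ '' (D : Set F)) (extLoc D φ A h S : Set L) ⊆
      IntOn (φ '' (mlocSet D S)) (extLoc D φ A h S : Set L) := by
  rintro f hf _ ⟨x, ⟨a, s, hs, hx⟩, rfl⟩
  refine eval_mem_of_mul_mem (fun d => le_extLoc h S (h d)) s.2
    (fun h0 => hS (Subtype.ext (a1 := s) (a2 := 0) h0 ▸ hs)) (inv_mem_extLoc h hS hs) ?_ hf
  rw [hx]
  exact a.2

theorem intOn_mono_right {E B B' : Set F} (h : B ⊆ B') : IntOn E B ⊆ IntOn E B' :=
  fun _ hf x hx => h (hf x hx)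

theorem intR_subset_intR_mlocSet (D : Subring F) {S : Submonoid D} (hS : (0 : D) ∉ S) :
    IntR (D : Set F) ⊆ IntR (mlocSet D S) := by
  intro f hf
  have h := intOn_subset_intOn_extLoc (extMem_id D) hS (a := f)
    (intOn_mono_right (le_extLoc (extMem_id D) S) (by simpa [IntR] using hf))
  rw [coe_extLoc_id] at h
  simpa [IntR] using h

theorem exists_mul_mem_span {D : Subring F} {φ : F →+* L} {A B : Subring L}
    (h : ExtMem D φ A) (S : Submonoid D) (hB : ∀ x ∈ B, ∃ s ∈ S, φ s * x ∈ A)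
    {G H : Set F[X]} (hGH : ∀ g ∈ H, ∃ s ∈ S, C (s : F) * g ∈ G) {f : L[X]}
    (hf : f ∈ Submodule.span B (Polynomial.map φ '' H)) :
    ∃ s ∈ S, C (φ s) * f ∈ Submodule.span A (Polynomial.map φ '' G) := by
  have hsm : ∀ (d : L), d ∈ A → ∀ f ∈ Submodule.span A (Polynomial.map φ '' G),
      C d * f ∈ Submodule.span A (Polynomial.map φ '' G) := by
    intro d hd f hf
    rw [← subring_smul_eq_C_mul (⟨d, hd⟩ : A)]
    exact Submodule.smul_mem _ _ hf
  induction hf using Submodule.span_induction with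
  | mem f hf =>
    obtain ⟨g, hg, rfl⟩ := hf
    obtain ⟨s, hs, hsg⟩ := hGH g hg
    refine ⟨s, hs, Submodule.subset_span ⟨_, hsg, ?_⟩⟩
    simp
  | zero => exact ⟨1, S.one_mem, by simp⟩
  | add f g _ _ hf hg =>
    obtain ⟨s, hs, hf⟩ := hf
    obtain ⟨t, ht, hg⟩ := hg
    refine ⟨s * t, S.mul_mem hs ht, ?_⟩
    have : C (φ ((s * t : D) : F)) * (f + g) =
        C (φ t) * (C (φ s) * f) + C (φ s) * (C (φ t) * g) := by
      push_cast
      rw [map_mul, map_mul]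
      ring
    rw [this]
    exact add_mem (hsm _ (h t) _ hf) (hsm _ (h s) _ hg)
  | smul b f _ hf =>
    obtain ⟨s, hs, hf⟩ := hf
    obtain ⟨t, ht, hb⟩ := hB b b.2
    refine ⟨s * t, S.mul_mem hs ht, ?_⟩
    have : C (φ ((s * t : D) : F)) * (b • f) = C (φ t * b) * (C (φ s) * f) := by
      rw [subring_smul_eq_C_mul]
      push_cast
      rw [map_mul, map_mul, map_mul]
      ring
    rw [this]
    exact hsm _ hb _ hf

theorem exists_mul_mem_of_finset {D : Subring F} {φ : F →+* L} {A : Subring L}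
    (h : ExtMem D φ A) (S : Submonoid D) (T : Finset L)
    (hT : ∀ x ∈ T, ∃ s ∈ S, φ s * x ∈ A) : ∃ s ∈ S, ∀ x ∈ T, φ s * x ∈ A := by
  classical
  induction T using Finset.induction_on with
  | empty => exact ⟨1, S.one_mem, by simp⟩
  | insert a T _ ih =>
    obtain ⟨s, hs, hsT⟩ := ih fun x hx => hT x (Finset.mem_insert_of_mem hx)
    obtain ⟨t, ht, hta⟩ := hT a (Finset.mem_insert_self a T)
    refine ⟨s * t, S.mul_mem hs ht, fun x hx => ?_⟩
    push_cast
    rw [map_mul]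
    rcases Finset.mem_insert.1 hx with rfl | hx
    · rw [mul_assoc]
      exact A.mul_mem (h s) hta
    · rw [mul_comm (φ s), mul_assoc]
      exact A.mul_mem (h t) (hsT x hx)

/-- A localization of `D` is a t-linked extension. -/
theorem tLinkedExt_extLoc (D : Subring F) (S : Submonoid D) (h) :
    TLinkedExt D (RingHom.id F) (extLoc D (RingHom.id F) D (extMem_id D) S) h := by
  classical
  intro I hI hIt
  have h1 : (1 : F) ∈ dt (D : Set F) (iset D (I : Set D)) := by
    rw [hIt]
    exact D.one_mem
  obtain ⟨T, hT, h0, hv⟩ := h1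
  refine dt_eq_of_one_mem (iset_subset _ _) ⟨T, fun x hx => ?_, h0, fun y hy => ?_⟩
  · obtain ⟨d, hd, rfl⟩ := hT hx
    exact ⟨_, Ideal.mem_map_of_mem _ hd, rfl⟩
  · rw [one_mul]
    obtain ⟨s, hs, hsT⟩ := exists_mul_mem_of_finset (extMem_id D) S (T.image (y * ·))
      (fun x hx => by
        obtain ⟨t, ht, rfl⟩ := Finset.mem_image.1 hx
        exact hy t ht)
    refine ⟨s, hs, ?_⟩
    rw [← one_mul (_ * y)]
    refine hv _ fun t ht => ?_
    rw [mul_assoc]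
    exact hsT _ (Finset.mem_image_of_mem _ ht)

theorem tLinkedExt_of_primeLoc {D : Subring F} {p : Ideal D} (hp : p.IsPrime) (hpt : IsTMax D p)
    {φ : F →+* L} {A : Subring L} (h : ExtMem D φ A) (h' : ExtMem (primeLoc D p hp) φ A) :
    TLinkedExt D φ A h := by
  intro I _ hIt
  have hIp : ¬ I ≤ p := fun hle => by
    have h1 : (1 : F) ∈ dt (D : Set F) (iset D (I : Set D)) := by
      rw [hIt]
      exact D.one_mem
    have h2 := dt_mono (iset_mono hle) h1
    rw [hpt.2.1] at h2
    exact hpt.1 ((Ideal.eq_top_iff_one p).2 (coe_mem_iset.1 h2))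
  obtain ⟨s, hsI, hsp⟩ := SetLike.not_le_iff_exists.1 hIp
  have hs0 : (s : F) ≠ 0 := fun h0 => hsp (by
    rw [Subtype.ext (a1 := s) (a2 := 0) h0]
    exact zero_mem p)
  have hinv : (φ s)⁻¹ ∈ A := by
    rw [← map_inv₀]
    exact h' ⟨(s : F)⁻¹, 1, s, hsp, by simp [hs0]⟩
  have htop : Ideal.map (extHom D φ A h) I = ⊤ := by
    rw [Ideal.eq_top_iff_one]
    have := Ideal.mul_mem_left _ (⟨_, hinv⟩ : A) (Ideal.mem_map_of_mem (extHom D φ A h) hsI)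
    convert this
    refine Subtype.ext ?_
    exact (inv_mul_cancel₀ ((map_ne_zero φ).2 hs0)).symm
  refine dt_eq_of_one_mem (iset_subset _ _) ⟨{1}, ?_, ⟨1, by simp⟩, subset_dv _ _ (by simp)⟩
  rw [htop]
  rw [Finset.coe_singleton, Set.singleton_subset_iff]
  exact ⟨1, trivial, rfl⟩

theorem PTReg.plReg {D : Subring F} (hqf : IsQuotField D) (hD : PTReg D) : PLReg D := by
  intro S hS
  have hle := le_extLoc (extMem_id D) S
  have hext : ExtMem D (RingHom.id F) (extLoc D (RingHom.id F) D (extMem_id D) S) :=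
    fun d => hle d.2
  have hreg := hD F (RingHom.id F) _ hext (hqf.mono hle) (tLinkedExt_extLoc D S _)
  apply Set.Subset.antisymm
  · intro f hf
    have hf' : f ∈ IntOn (RingHom.id F '' (D : Set F))
        (extLoc D (RingHom.id F) D (extMem_id D) S : Set F) := by
      rw [coe_extLoc_id]
      rintro _ ⟨d, hd, rfl⟩
      exact hf d ⟨⟨d, hd⟩, 1, S.one_mem, by simp⟩
    rw [hreg] at hf'
    obtain ⟨s, hs, hsf⟩ := exists_mul_mem_span (extMem_id D) S (fun x hx => hx)
      (G := IntR (D : Set F)) (fun g hg => ⟨1, S.one_mem, by simpa using hg⟩) hf'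
    exact ⟨_, by simpa [IntR] using span_subset_intOn (extMem_id D) hsf, s, hs, rfl⟩
  · rintro f ⟨g, hg, s, hs, rfl⟩ x hx
    have h1 := intR_subset_intR_mlocSet D hS hg x hx
    rw [← coe_extLoc_id] at h1 ⊢
    rw [eval_mul, eval_C] at h1
    have h2 := Subring.mul_mem _ (inv_mem_extLoc (extMem_id D) hS hs) h1
    have hs0 : (s : F) ≠ 0 := fun h0 => hS (Subtype.ext (a1 := s) (a2 := 0) h0 ▸ hs)
    rwa [RingHom.id_apply, inv_mul_cancel_left₀ hs0] at h2

theorem zero_notMem_primeCompl {D : Subring F} (p : Ideal D) [p.IsPrime] :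
    (0 : D) ∉ p.primeCompl := fun h => h (zero_mem p)

theorem le_primeLoc {D : Subring F} {p : Ideal D} (hp : p.IsPrime) : D ≤ primeLoc D p hp :=
  fun d hd => ⟨⟨d, hd⟩, 1, (Ideal.ne_top_iff_one p).1 hp.ne_top, by simp⟩

theorem coe_primeLoc {D : Subring F} {p : Ideal D} (hp : p.IsPrime) :
    (primeLoc D p hp : Set F) = mlocSet D (p.primeCompl : Submonoid D) := rfl

theorem PTReg.absPolyReg {D : Subring F} (hD : PTReg D) {p : Ideal D} (hp : p.IsPrime)
    (hpt : IsTMax D p) : AbsPolyReg (primeLoc D p hp) := by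
  intro L _ φ A hA hqA
  have h : ExtMem D φ A := fun d => hA ⟨d, le_primeLoc hp d.2⟩
  have hreg := hD L φ A h hqA (tLinkedExt_of_primeLoc hp hpt h hA)
  refine Set.Subset.antisymm (fun f hf => ?_) (span_subset_intOn hA)
  have hf' : f ∈ IntOn (φ '' (D : Set F)) (A : Set L) := by
    rintro _ ⟨d, hd, rfl⟩
    exact hf _ ⟨d, le_primeLoc hp hd, rfl⟩
  rw [hreg] at hf'
  exact Submodule.span_mono
    (Set.image_mono (intR_subset_intR_mlocSet D (zero_notMem_primeCompl p))) hf'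

/-- Finitely many relations in a flat module can be trivialized simultaneously. -/
theorem exists_trivialization {R M : Type*} [CommRing R] [AddCommGroup M] [Module R M]
    [Module.Flat R M] {ι : Type*} [Fintype ι] (m : ι → M) (Q : Finset (ι → R))
    (hQ : ∀ q ∈ Q, ∑ i, q i • m i = 0) :
    ∃ (k : ℕ) (n : Fin k → M) (u : Fin k → ι → R), (∀ i, m i = ∑ l, u l i • n l) ∧
      ∀ q ∈ Q, ∀ l, ∑ i, q i * u l i = 0 := by
  classical
  have h : Fintype.linearCombination R m ∘ₗ (Submodule.span R (Q : Set (ι → R))).subtype = 0 := by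
    ext ⟨x, hx⟩
    have : Submodule.span R (Q : Set (ι → R)) ≤ LinearMap.ker (Fintype.linearCombination R m) :=
      Submodule.span_le.2 fun q hq => by simpa [Fintype.linearCombination_apply] using hQ q hq
    exact this hx
  obtain ⟨k, a, y, hay, haf⟩ := Module.Flat.exists_factorization_of_comp_eq_zero_of_free h
  refine ⟨k, fun l => y (Finsupp.single l 1), fun l i => a (Pi.single i 1) l, fun i => ?_,
    fun q hq l => ?_⟩
  · have h1 := LinearMap.congr_fun hay (Pi.single i 1)
    rw [Fintype.linearCombination_apply_single, one_smul, LinearMap.comp_apply] at h1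
    rw [h1]
    conv_lhs => rw [← Finsupp.univ_sum_single (a (Pi.single i 1))]
    rw [map_sum]
    refine Finset.sum_congr rfl fun l _ => ?_
    rw [← map_smul, Finsupp.smul_single, smul_eq_mul, mul_one]
  · have h1 := LinearMap.congr_fun haf ⟨q, Submodule.subset_span hq⟩
    have h2 : a q = 0 := h1
    rw [pi_eq_sum_univ' q, map_sum] at h2
    have h3 := DFunLike.congr_fun h2 l
    rw [Finsupp.finsetSum_apply] at h3
    simp only [map_smul, Finsupp.smul_apply, smul_eq_mul, Finsupp.zero_apply] at h3
    convert h3 using 4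

/-- Linear relations over `L` between polynomials over `F` are consequences of finitely
many relations over `D`. -/
theorem exists_relations {D : Subring F} (hqf : IsQuotField D) (φ : F →+* L) {ι : Type*}
    [Fintype ι] (m : ι → F[X]) (c : ι → L) (hc : ∑ i, C (c i) * (m i).map φ = 0) :
    ∃ Q : Finset (ι → D), (∀ q ∈ Q, ∑ i, C (q i : F) * m i = 0) ∧
      ∀ u : ι → D, (∀ q ∈ Q, ∑ i, q i * u i = 0) → ∑ i, c i * φ (u i) = 0 := by
  classical
  let : Algebra F L := φ.toAlgebra
  let e := Module.Basis.ofVectorSpace F L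
  have hcomb : ∀ (k) (v : ι → F), ∑ i, c i * φ (v i) = 0 → ∑ i, e.repr (c i) k * v i = 0 := by
    intro k v hv
    have h1 := congrArg (fun x => e.repr x k) hv
    have h2 : ∀ i, c i * φ (v i) = v i • c i := fun i => by
      rw [Algebra.smul_def, mul_comm]
      rfl
    simp only [h2, map_sum, map_smul, map_zero, Finsupp.zero_apply, Finsupp.finsetSum_apply,
      Finsupp.smul_apply, smul_eq_mul] at h1
    simpa only [mul_comm] using h1
  let K := Finset.univ.biUnion fun i => (e.repr (c i)).support
  obtain ⟨δ, hδ0, hδ⟩ := exists_mul_mem_of_finset (extMem_id D) (nonZeroDivisors D)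
    ((Finset.univ ×ˢ K).image fun ik => e.repr (c ik.1) ik.2) fun x _ => by
      obtain ⟨a, b, hb, hx⟩ := hqf x
      refine ⟨b, mem_nonZeroDivisors_of_ne_zero hb, ?_⟩
      rw [RingHom.id_apply, hx]
      exact a.2
  have hδF : (δ : F) ≠ 0 := by simpa using nonZeroDivisors.ne_zero hδ0
  have hmem : ∀ k i, (δ : F) * e.repr (c i) k ∈ D := by
    intro k i
    by_cases hk : k ∈ K
    · have := hδ (e.repr (c i) k)
        (Finset.mem_image.2 ⟨(i, k), Finset.mem_product.2 ⟨Finset.mem_univ i, hk⟩, rfl⟩)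
      rwa [RingHom.id_apply] at this
    · have : e.repr (c i) k = 0 := by
        by_contra h
        exact hk (Finset.mem_biUnion.2 ⟨i, Finset.mem_univ i, Finsupp.mem_support_iff.2 h⟩)
      simp [this, D.zero_mem]
  choose γ hγ using fun k i => (⟨⟨_, hmem k i⟩, rfl⟩ :
    ∃ d : D, (d : F) = δ * e.repr (c i) k)
  refine ⟨K.image γ, fun q hq => ?_, fun u hu => ?_⟩
  · obtain ⟨k, -, rfl⟩ := Finset.mem_image.1 hq
    ext n
    have h1 : ∑ i, c i * φ ((m i).coeff n) = 0 := by
      simpa [finsetSum_coeff] using congrArg (fun f => coeff f n) hc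
    have h2 := hcomb k _ h1
    simp only [finsetSum_coeff, coeff_C_mul, coeff_zero]
    rw [← mul_zero (δ : F), ← h2, Finset.mul_sum]
    simp only [hγ, mul_assoc]
  · have h2 : ∀ i, c i * φ (u i) = (u i : F) • c i := fun i => by
      rw [Algebra.smul_def, mul_comm]
      rfl
    refine e.repr.map_eq_zero_iff.1 (Finsupp.ext fun k => ?_)
    simp only [h2, map_sum, map_smul, Finsupp.zero_apply, Finsupp.finsetSum_apply,
      Finsupp.smul_apply, smul_eq_mul]
    by_cases hk : k ∈ K
    · have h3 := congrArg (Subtype.val) (hu _ (Finset.mem_image_of_mem _ hk))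
      push_cast at h3
      simp only [hγ] at h3
      have h4 : (δ : F) * ∑ i, (u i : F) * e.repr (c i) k = 0 := by
        rw [← h3, Finset.mul_sum]
        exact Finset.sum_congr rfl fun i _ => by ring
      exact (mul_eq_zero.1 h4).resolve_left hδF
    · refine Finset.sum_eq_zero fun i _ => ?_
      have : e.repr (c i) k = 0 := by
        by_contra h
        exact hk (Finset.mem_biUnion.2 ⟨i, Finset.mem_univ i, Finsupp.mem_support_iff.2 h⟩)
      rw [this, mul_zero]

/-- For flat `Int(D)`, the module `A·Int(D)` is closed under division by a finite set of
elements of `D` whose inverse in `A` is `A`. -/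
theorem mem_span_of_forall_mul_mem {D : Subring F} (hqf : IsQuotField D)
    [Module.Flat D (intSubmodule D)] {φ : F →+* L} {A : Subring L} (h : ExtMem D φ A)
    {T : Finset D} {t₀ : D} (ht₀ : t₀ ∈ T) (ht₀0 : t₀ ≠ 0)
    (hT : ∀ y : L, (∀ t ∈ T, y * φ t ∈ A) → y ∈ A) {f : L[X]}
    (hf : ∀ t ∈ T, C (φ t) * f ∈ Submodule.span A (Polynomial.map φ '' IntR (D : Set F))) :
    f ∈ Submodule.span A (Polynomial.map φ '' IntR (D : Set F)) := by
  classical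
  have hrange : Polynomial.map φ '' IntR (D : Set F) =
      Set.range fun m : intSubmodule D => (m : F[X]).map φ := by
    ext g
    exact ⟨fun ⟨m, hm, hg⟩ => ⟨⟨m, hm⟩, hg⟩, fun ⟨m, hg⟩ => ⟨m, m.2, hg⟩⟩
  have hex : ∀ t : D, ∃ b : intSubmodule D →₀ A, t ∈ T →
      b.sum (fun m a => a • (m : F[X]).map φ) = C (φ t) * f := by
    intro t
    by_cases ht : t ∈ T
    · have := hf t ht
      rw [hrange, Finsupp.mem_span_range_iff_exists_finsupp] at this
      obtain ⟨b, hb⟩ := this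
      exact ⟨b, fun _ => hb⟩
    · exact ⟨0, fun h => absurd h ht⟩
  choose b hb using hex
  let U := T.biUnion fun t => (b t).support
  have hb' : ∀ t ∈ T, ∑ m : U, C (b t m : L) * ((m : intSubmodule D) : F[X]).map φ =
      C (φ t) * f := by
    intro t ht
    rw [← hb t ht, Finsupp.sum_of_support_subset (b t)
      (Finset.subset_biUnion_of_mem (fun t => (b t).support) ht) _ (by simp)]
    simp only [subring_smul_eq_C_mul]
    exact Finset.sum_coe_sort U fun m => C (b t m : L) * (m : F[X]).map φ
  have hφ0 : φ t₀ ≠ 0 := (map_ne_zero φ).2 (by simpa using ht₀0)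
  let l : U → L := fun m => (φ t₀)⁻¹ * b t₀ m
  have hl : f = ∑ m : U, C (l m) * ((m : intSubmodule D) : F[X]).map φ := by
    have : f = C (φ t₀)⁻¹ * (C (φ t₀) * f) := by
      rw [← mul_assoc, ← C_mul, inv_mul_cancel₀ hφ0, C_1, one_mul]
    rw [this, ← hb' t₀ ht₀, Finset.mul_sum]
    simp only [l, C_mul, mul_assoc]
  have hrel : ∀ t : D, ∃ Q : Finset (U → D), t ∈ T →
      (∀ q ∈ Q, ∑ i, C (q i : F) * ((i : intSubmodule D) : F[X]) = 0) ∧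
      ∀ u : U → D, (∀ q ∈ Q, ∑ i, q i * u i = 0) →
        ∑ i, (φ t * l i - b t i) * φ (u i) = 0 := by
    intro t
    by_cases ht : t ∈ T
    · obtain ⟨Q, hQ⟩ := exists_relations hqf φ (fun i : U => ((i : intSubmodule D) : F[X]))
        (fun i => φ t * l i - b t i) (by
          simp only [C_sub, C_mul, sub_mul, Finset.sum_sub_distrib, mul_assoc]
          rw [hb' t ht, ← Finset.mul_sum, ← hl, sub_self])
      exact ⟨Q, fun _ => hQ⟩
    · exact ⟨∅, fun h => absurd h ht⟩
  choose Q hQ using hrel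
  obtain ⟨k, n, u, hu, hQu⟩ := exists_trivialization (fun i : U => (i : intSubmodule D))
    (T.biUnion Q) (fun q hq => by
      obtain ⟨t, ht, hq⟩ := Finset.mem_biUnion.1 hq
      refine Subtype.ext ?_
      rw [Submodule.coe_sum, Submodule.coe_zero, ← (hQ t ht).1 q hq]
      refine Finset.sum_congr rfl fun i _ => ?_
      rw [Submodule.coe_smul, subring_smul_eq_C_mul])
  have hμ : ∀ j, ∑ i, l i * φ (u j i) ∈ A := by
    refine fun j => hT _ fun t ht => ?_
    have h1 := (hQ t ht).2 (u j) fun q hq => hQu q (Finset.mem_biUnion.2 ⟨t, ht, hq⟩) j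
    simp only [sub_mul, Finset.sum_sub_distrib, mul_assoc] at h1
    rw [← Finset.mul_sum, sub_eq_zero] at h1
    rw [mul_comm, h1]
    exact A.sum_mem fun i _ => A.mul_mem (b t i).2 (h _)
  have hfn : f = ∑ j, (⟨_, hμ j⟩ : A) • (n j : F[X]).map φ := by
    simp only [subring_smul_eq_C_mul]
    rw [hl]
    have h1 : ∀ i : U, ((i : intSubmodule D) : F[X]).map φ =
        ∑ j, C (φ (u j i)) * (n j : F[X]).map φ := by
      intro i
      have h2 := congrArg (fun m : intSubmodule D => (m : F[X]).map φ) (hu i)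
      simp only [Submodule.coe_sum, Submodule.coe_smul, subring_smul_eq_C_mul,
        Polynomial.map_sum, Polynomial.map_mul, map_C] at h2
      exact h2
    simp only [h1, map_sum, Finset.sum_mul, Finset.mul_sum, C_mul]
    rw [Finset.sum_comm]
    simp only [mul_assoc]
  rw [hfn]
  exact Submodule.sum_mem _ fun j _ =>
    Submodule.smul_mem _ _ (Submodule.subset_span ⟨_, (n j).2, rfl⟩)

/-- The elements of `D` multiplying `f` into `A·Int(D)`. -/
def denomIdeal (D : Subring F) (φ : F →+* L) (A : Subring L) (h : ExtMem D φ A) (f : L[X]) :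
    Ideal D where
  carrier := {d | C (φ d) * f ∈ Submodule.span A (Polynomial.map φ '' IntR (D : Set F))}
  zero_mem' := by simp
  add_mem' := fun {a b} ha hb => by
    have : C (φ ((a + b : D) : F)) * f = C (φ a) * f + C (φ b) * f := by
      push_cast
      rw [map_add, C_add, add_mul]
    rw [Set.mem_ofPred_eq, this]
    exact add_mem ha hb
  smul_mem' := fun c a ha => by
    have : C (φ ((c • a : D) : F)) * f = (⟨_, h c⟩ : A) • (C (φ a) * f) := by
      rw [subring_smul_eq_C_mul, smul_eq_mul]
      push_cast
      rw [map_mul, C_mul, mul_assoc]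
    rw [Set.mem_ofPred_eq, this]
    exact Submodule.smul_mem _ _ ha

theorem not_denomIdeal_le {D : Subring F} (hL : PLReg D) {p : Ideal D} (hp : p.IsPrime)
    (hreg : AbsPolyReg (primeLoc D p hp)) {φ : F →+* L} {A : Subring L} (h : ExtMem D φ A)
    (hqA : IsQuotField A) {f : L[X]} (hf : f ∈ IntOn (φ '' (D : Set F)) (A : Set L)) :
    ¬ denomIdeal D φ A h f ≤ p := by
  intro hle
  have hS := zero_notMem_primeCompl p
  have hext : ExtMem (primeLoc D p hp) φ (extLoc D φ A h p.primeCompl) := by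
    rintro ⟨x, a, s, hs, hx⟩
    refine ⟨s, hs, ?_⟩
    rw [← map_mul, hx]
    exact h a
  have hf' := intOn_subset_intOn_extLoc h hS (intOn_mono_right (le_extLoc h _) hf)
  rw [← coe_primeLoc hp, hreg L φ _ hext (hqA.mono (le_extLoc h _))] at hf'
  obtain ⟨s, hs, hsf⟩ := exists_mul_mem_span h p.primeCompl (fun x hx => hx)
    (G := IntR (D : Set F)) (fun g hg => by
      rw [coe_primeLoc hp, hL p.primeCompl hS] at hg
      obtain ⟨g', hg', s, hs, rfl⟩ := hg
      exact ⟨s, hs, hg'⟩) hf'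
  exact hs (hle hsf)

theorem TLinkedExt.mem_of_forall_mul_mem {D : Subring F} {φ : F →+* L} {A : Subring L}
    {h : ExtMem D φ A} (hlink : TLinkedExt D φ A h) {I : Ideal D} (hI : I ≠ ⊥)
    (hIt : dt (D : Set F) (iset D (I : Set D)) = D) {y : L} (hy : ∀ t ∈ I, y * φ t ∈ A) :
    y ∈ A := by
  have h1 : (1 : L) ∈ dt (A : Set L) (iset A (Ideal.map (extHom D φ A h) I : Set A)) := by
    rw [hlink I hI hIt]
    exact A.one_mem
  obtain ⟨T, hT, -, hv⟩ := h1
  rw [← one_mul y]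
  refine hv y fun z hz => ?_
  obtain ⟨a, ha, rfl⟩ := hT hz
  clear hz
  induction ha using Submodule.span_induction with
  | mem a ha =>
    obtain ⟨t, ht, rfl⟩ := ha
    exact hy t ht
  | zero => simp [A.zero_mem]
  | add a b _ _ ha hb =>
    push_cast
    rw [mul_add]
    exact A.add_mem ha hb
  | smul c a _ ha =>
    rw [smul_eq_mul]
    push_cast
    rw [mul_left_comm]
    exact A.mul_mem c.2 ha

theorem PLReg.ptReg {D : Subring F} (hqf : IsQuotField D) (hne : (D : Set F) ≠ Set.univ)
    [Module.Flat D (intSubmodule D)] (hL : PLReg D)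
    (hreg : ∀ p : Ideal D, ∀ hp : p.IsPrime, IsTMax D p → AbsPolyReg (primeLoc D p hp)) :
    PTReg D := by
  classical
  intro L _ φ A h hqA hlink
  refine Set.Subset.antisymm (fun f hf => ?_) (span_subset_intOn h)
  have h1 : (1 : F) ∈ dt (D : Set F) (iset D (denomIdeal D φ A h f : Set D)) := by
    by_contra hnot
    obtain ⟨p, hp, hpt, hle⟩ := exists_isTMax hqf hne hnot
    exact not_denomIdeal_le hL hp (hreg p hp hpt) h hqA hf hle
  obtain ⟨T, hT, ⟨y, hyT, hy0⟩, hv⟩ := h1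
  obtain ⟨U, hU, rfl⟩ := Finset.subset_set_image_iff.1 hT
  obtain ⟨t₀, ht₀, rfl⟩ := Finset.mem_image.1 hyT
  have ht₀0 : t₀ ≠ 0 := by simpa using hy0
  refine mem_span_of_forall_mul_mem hqf h ht₀ ht₀0 (fun z hz => ?_) fun t ht => hU ht
  refine hlink.mem_of_forall_mul_mem (I := Ideal.span U) (fun hbot => ht₀0 ?_)
    (dt_eq_of_one_mem (iset_subset _ _) ⟨_, ?_, ⟨_, hyT, hy0⟩, hv⟩) fun t ht => ?_
  · exact (Submodule.eq_bot_iff _).1 hbot t₀ (Ideal.subset_span ht₀)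
  · intro x hx
    obtain ⟨t, ht, rfl⟩ := Finset.mem_image.1 (Finset.mem_coe.1 hx)
    exact coe_mem_iset.2 (Ideal.subset_span ht)
  · induction ht using Submodule.span_induction with
    | mem t ht => exact hz t ht
    | zero => simp [A.zero_mem]
    | add a b _ _ ha hb =>
      push_cast
      rw [map_add, mul_add]
      exact A.add_mem ha hb
    | smul c a _ ha =>
      rw [smul_eq_mul]
      push_cast
      rw [map_mul, mul_left_comm]
      exact A.mul_mem (h c) ha

end IVP

/-- (i) If every t-linked extension of `D` is polynomially regular,
then `D` is polynomially L-regular and `D_p` is absolutely polynomially regular for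
every t-maximal ideal `p` of `D`.  (ii) If in addition `Int(D)` is flat as a
`D`-module, then the converse holds. -/
theorem stmt_17 (F : Type) [Field F] (D : Subring F)
    (hqf : IsQuotField D) (hne : (↑D : Set F) ≠ Set.univ) :
    (PTReg D →
        PLReg D ∧ ∀ p : Ideal ↥D, ∀ hp : p.IsPrime, IsTMax D p →
          AbsPolyReg (primeLoc D p hp)) ∧
      (Module.Flat ↥D ↥(intSubmodule D) →
        (PLReg D ∧ ∀ p : Ideal ↥D, ∀ hp : p.IsPrime, IsTMax D p →
          AbsPolyReg (primeLoc D p hp)) →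
        PTReg D) :=
  ⟨fun h => ⟨h.plReg hqf, fun _ hp hpt => h.absPolyReg hp hpt⟩,
    fun _ h => PLReg.ptReg hqf hne h.1 h.2⟩
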